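/- Let p ≥ q ≥ 1 and let A, B be complex p×q matrices. For any subset {i_1 < i_2 < … < i_r} of [q] and any index s ∈ [r], the signed Lidskii inequality ∑_{k≠s} τ_{i_k}(A+B) − τ_{i_s}(A+B) ≤ ∑_{k≠s} τ_{i_k}(B) − τ_{i_s}(B) + ∑_{k=1}^r τ_k(A) holds. -/

import Mathlib

open Matrix

/-- The eigenvalues of a Hermitian matrix, listed in decreasing order. -/
noncomputable def eigsDesc {n : ℕ} {A : Matrix (Fin n) (Fin n) ℂ} (hA : A.IsHermitian) :
    Fin n → ℝ :=
  fun i => hA.eigenvalues (Tuple.sort hA.eigenvalues i.rev)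

/-- The singular values of a complex `p × q` matrix, listed in decreasing order:
the square roots of the eigenvalues of the Hermitian matrix `Aᴴ * A`. -/
noncomputable def singularValues {p q : ℕ} (A : Matrix (Fin p) (Fin q) ℂ) : Fin q → ℝ :=
  fun i => Real.sqrt (eigsDesc (Matrix.isHermitian_conjTranspose_mul_self A) i)

/-- `sval A k` is the `k`-th singular value `τ_k(A)` of `A`, with 1-based indexing
(junk value `0` out of range). -/
noncomputable def sval {p q : ℕ} (A : Matrix (Fin p) (Fin q) ℂ) (k : ℕ) : ℝ :=
  if h : k - 1 < q then singularValues A ⟨k - 1, h⟩ else 0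

section
variable {E : Type*} [NormedAddCommGroup E] [InnerProductSpace ℂ E] [FiniteDimensional ℂ E]

/-- The quadratic form of a symmetric operator in coordinates of an eigenvector basis. -/
theorem LinearMap.IsSymmetric.re_inner_apply_eq_sum {n : ℕ} {T : E →ₗ[ℂ] E} (hT : T.IsSymmetric)
    (hn : Module.finrank ℂ E = n) (x : E) :
    (inner ℂ x (T x)).re =
      ∑ i, hT.eigenvalues hn i * ‖inner ℂ (hT.eigenvectorBasis hn i) x‖ ^ 2 := by
  rw [← (hT.eigenvectorBasis hn).sum_inner_mul_inner x (T x), Complex.re_sum]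
  refine Finset.sum_congr rfl fun i _ => ?_
  rw [← hT (hT.eigenvectorBasis hn i) x, hT.apply_eigenvectorBasis hn i, inner_smul_left,
    ← inner_conj_symm x, mul_left_comm, RCLike.conj_mul]
  simp [← Complex.ofReal_pow]

/-- Weyl's monotonicity principle, with a shift. -/
theorem LinearMap.IsSymmetric.eigenvalues_le_add {n : ℕ} {S T : E →ₗ[ℂ] E}
    (hS : S.IsSymmetric) (hT : T.IsSymmetric) (hn : Module.finrank ℂ E = n) {t : ℝ}
    (h : ∀ x, (inner ℂ x (S x)).re ≤ (inner ℂ x (T x)).re + t * ‖x‖ ^ 2) (i : Fin n) :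
    hS.eigenvalues hn i ≤ hT.eigenvalues hn i + t := by
  classical
  let L : E →ₗ[ℂ] ({j : Fin n // j ≠ i} → ℂ) := LinearMap.pi fun j =>
    if j.1 < i then (innerₛₗ ℂ (hT.eigenvectorBasis hn j.1))
    else (innerₛₗ ℂ (hS.eigenvectorBasis hn j.1))
  have hker : LinearMap.ker L ≠ ⊥ := by
    apply LinearMap.ker_ne_bot_of_finrank_lt
    have := i.pos
    simp [hn]
    omega
  obtain ⟨x, hxL, hx0⟩ := Submodule.exists_mem_ne_zero_of_ne_bot hker
  have hL (j : Fin n) (hj : j ≠ i) : (if j < i then inner ℂ (hT.eigenvectorBasis hn j) x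
      else inner ℂ (hS.eigenvectorBasis hn j) x) = 0 := by
    have := congrFun (LinearMap.mem_ker.mp hxL) ⟨j, hj⟩
    simp only [L, LinearMap.pi_apply, Pi.zero_apply] at this
    split_ifs at this ⊢ <;> simpa using this
  have hx : 0 < ‖x‖ ^ 2 := by positivity
  have h1 : hS.eigenvalues hn i * ‖x‖ ^ 2 ≤ (inner ℂ x (S x)).re := by
    rw [hS.re_inner_apply_eq_sum hn, ← (hS.eigenvectorBasis hn).sum_sq_norm_inner_right,
      Finset.mul_sum]
    refine Finset.sum_le_sum fun j _ => ?_
    rcases le_or_gt j i with hj | hj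
    · exact mul_le_mul_of_nonneg_right (hS.eigenvalues_antitone hn hj) (by positivity)
    · have := hL j hj.ne'
      rw [if_neg hj.not_gt] at this
      simp [this]
  have h2 : (inner ℂ x (T x)).re ≤ hT.eigenvalues hn i * ‖x‖ ^ 2 := by
    rw [hT.re_inner_apply_eq_sum hn, ← (hT.eigenvectorBasis hn).sum_sq_norm_inner_right,
      Finset.mul_sum]
    refine Finset.sum_le_sum fun j _ => ?_
    rcases lt_or_ge j i with hj | hj
    · have := hL j hj.ne
      rw [if_pos hj] at this
      simp [this]
    · exact mul_le_mul_of_nonneg_right (hT.eigenvalues_antitone hn hj) (by positivity)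
  have := h x
  refine le_of_mul_le_mul_right ?_ hx
  linarith

/-- The operator that is diagonal with entries `c` in an orthonormal basis `b`. -/
noncomputable def OrthonormalBasis.diagonalMap {κ : Type*} [Fintype κ]
    (b : OrthonormalBasis κ ℂ E) (c : κ → ℝ) : E →ₗ[ℂ] E :=
  ∑ j, (c j : ℂ) • (innerₛₗ ℂ (b j)).smulRight (b j)

omit [FiniteDimensional ℂ E] in
theorem OrthonormalBasis.inner_diagonalMap {κ : Type*} [Fintype κ]
    (b : OrthonormalBasis κ ℂ E) (c : κ → ℝ) (x y : E) :
    inner ℂ x (b.diagonalMap c y) = ∑ j, (c j : ℂ) * (inner ℂ x (b j) * inner ℂ (b j) y) := by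
  simp [diagonalMap, mul_comm]

omit [FiniteDimensional ℂ E] in
theorem OrthonormalBasis.isSymmetric_diagonalMap {κ : Type*} [Fintype κ]
    (b : OrthonormalBasis κ ℂ E) (c : κ → ℝ) : (b.diagonalMap c).IsSymmetric := by
  intro x y
  rw [← inner_conj_symm, inner_diagonalMap, inner_diagonalMap]
  simp [mul_comm]

omit [FiniteDimensional ℂ E] in
theorem OrthonormalBasis.re_inner_diagonalMap_self {κ : Type*} [Fintype κ]
    (b : OrthonormalBasis κ ℂ E) (c : κ → ℝ) (x : E) :
    (inner ℂ x (b.diagonalMap c x)).re = ∑ j, c j * ‖inner ℂ (b j) x‖ ^ 2 := by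
  rw [inner_diagonalMap, Complex.re_sum]
  refine Finset.sum_congr rfl fun j _ => ?_
  rw [← inner_conj_symm x, RCLike.conj_mul]
  simp [← Complex.ofReal_pow]

omit [FiniteDimensional ℂ E] in
theorem OrthonormalBasis.trace_diagonalMap {κ : Type*} [Fintype κ]
    (b : OrthonormalBasis κ ℂ E) (c : κ → ℝ) :
    LinearMap.trace ℂ E (b.diagonalMap c) = ∑ j, (c j : ℂ) := by
  classical
  rw [LinearMap.trace_eq_sum_inner _ b]
  simp [inner_diagonalMap, b.inner_eq_ite]

/-- **Lidskii's inequality** for symmetric operators. -/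
theorem LinearMap.IsSymmetric.sum_eigenvalues_add_le {n r : ℕ} {S T : E →ₗ[ℂ] E}
    (hS : S.IsSymmetric) (hT : T.IsSymmetric) (hn : Module.finrank ℂ E = n) (hr : r ≤ n)
    {f : Fin r → Fin n} (hf : Function.Injective f) :
    ∑ k, (hS.add hT).eigenvalues hn (f k) ≤
      ∑ k, hT.eigenvalues hn (f k) + ∑ k, hS.eigenvalues hn (Fin.castLE hr k) := by
  rcases Nat.eq_zero_or_pos r with rfl | hr0
  · simp
  set b := hS.eigenvectorBasis hn
  set t := hS.eigenvalues hn ⟨r - 1, by omega⟩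
  set c : Fin n → ℝ := fun j => max (hS.eigenvalues hn j - t) 0
  set P := b.diagonalMap c
  have hP : P.IsSymmetric := b.isSymmetric_diagonalMap c
  have hPx (x : E) : (inner ℂ x (P x)).re = ∑ j, c j * ‖inner ℂ (b j) x‖ ^ 2 :=
    b.re_inner_diagonalMap_self c x
  have h1 (i : Fin n) : (hS.add hT).eigenvalues hn i ≤ (hP.add hT).eigenvalues hn i + t := by
    refine (hS.add hT).eigenvalues_le_add (hP.add hT) hn (fun x => ?_) i
    simp only [LinearMap.add_apply, inner_add_right, Complex.add_re]
    rw [hS.re_inner_apply_eq_sum hn, hPx, ← b.sum_sq_norm_inner_right x, Finset.mul_sum]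
    have : ∑ j, hS.eigenvalues hn j * ‖inner ℂ (b j) x‖ ^ 2 ≤
        ∑ j, c j * ‖inner ℂ (b j) x‖ ^ 2 + ∑ j, t * ‖inner ℂ (b j) x‖ ^ 2 := by
      rw [← Finset.sum_add_distrib]
      refine Finset.sum_le_sum fun j _ => ?_
      rw [← add_mul]
      refine mul_le_mul_of_nonneg_right ?_ (by positivity)
      linarith [le_max_left (hS.eigenvalues hn j - t) 0]
    linarith
  have h2 (i : Fin n) : hT.eigenvalues hn i ≤ (hP.add hT).eigenvalues hn i := by
    have := hT.eigenvalues_le_add (hP.add hT) hn (t := 0) (fun x => ?_) i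
    · simpa using this
    simp only [LinearMap.add_apply, inner_add_right, Complex.add_re, hPx]
    have : 0 ≤ ∑ j, c j * ‖inner ℂ (b j) x‖ ^ 2 :=
      Finset.sum_nonneg fun j _ => mul_nonneg (le_max_right _ _) (by positivity)
    linarith
  have h3 : ∑ i, (hP.add hT).eigenvalues hn i = ∑ i, c i + ∑ i, hT.eigenvalues hn i := by
    have h := congrArg Complex.re (LinearMap.map_add (LinearMap.trace ℂ E) P T)
    rw [(hP.add hT).trace_eq_sum_eigenvalues hn, hT.trace_eq_sum_eigenvalues hn,
      b.trace_diagonalMap] at h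
    simpa using h
  have h4 : ∑ i, c i = ∑ k : Fin r, (hS.eigenvalues hn (Fin.castLE hr k) - t) := by
    rw [← Finset.sum_subset (Finset.subset_univ (Finset.univ.map (Fin.castLEEmb hr))),
      Finset.sum_map]
    · refine Finset.sum_congr rfl fun k _ => max_eq_left (sub_nonneg.mpr ?_)
      exact hS.eigenvalues_antitone hn (Fin.le_def.mpr (by simp; omega))
    · intro j _ hj
      refine max_eq_right (sub_nonpos.mpr (hS.eigenvalues_antitone hn (Fin.le_def.mpr ?_)))
      by_contra hlt
      simp only [not_le] at hlt
      exact hj (Finset.mem_map.mpr ⟨⟨j, by omega⟩, Finset.mem_univ _, rfl⟩)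
  have h5 : ∑ k, ((hP.add hT).eigenvalues hn (f k) - hT.eigenvalues hn (f k)) ≤
      ∑ i, ((hP.add hT).eigenvalues hn i - hT.eigenvalues hn i) := by
    refine (Finset.sum_map Finset.univ ⟨f, hf⟩
      fun i => (hP.add hT).eigenvalues hn i - hT.eigenvalues hn i).symm.trans_le ?_
    exact Finset.sum_le_sum_of_subset_of_nonneg (Finset.subset_univ _)
      fun i _ _ => sub_nonneg.mpr (h2 i)
  have h6 := Finset.sum_le_sum fun k (_ : k ∈ Finset.univ) => h1 (f k)
  rw [Finset.sum_add_distrib] at h6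
  rw [Finset.sum_sub_distrib] at h4
  rw [Finset.sum_sub_distrib, Finset.sum_sub_distrib] at h5
  linarith

/-- A decreasing family of reals which are the roots of the characteristic polynomial is the
family of eigenvalues. -/
theorem LinearMap.IsSymmetric.eigenvalues_eq_of_charpoly_eq {n : ℕ} {T : E →ₗ[ℂ] E}
    (hT : T.IsSymmetric) (hn : Module.finrank ℂ E = n) {d : Fin n → ℝ} (hd : Antitone d)
    (h : T.charpoly = ∏ i, (Polynomial.X - Polynomial.C (d i : ℂ))) :
    hT.eigenvalues hn = d := by
  rw [← List.ofFn_inj, ← hT.sort_roots_charpoly_eq_eigenvalues hn, h, Polynomial.roots_prod]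
  · simp only [Polynomial.roots_X_sub_C, Multiset.bind_singleton, Fin.univ_val_map,
      Multiset.map_coe, List.map_ofFn, Function.comp_def, RCLike.re_to_complex,
      Complex.ofReal_re, Multiset.coe_sort]
    apply List.mergeSort_of_pairwise
    simp_rw [decide_eq_true_eq, ← List.sortedGE_iff_pairwise]
    exact hd.sortedGE_ofFn
  · simp [Finset.prod_ne_zero_iff, Polynomial.X_sub_C_ne_zero]

end

theorem eigsDesc_antitone {n : ℕ} {A : Matrix (Fin n) (Fin n) ℂ} (hA : A.IsHermitian) :
    Antitone (eigsDesc hA) :=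
  fun _ _ hij => Tuple.monotone_sort hA.eigenvalues (Fin.rev_le_rev.mpr hij)

theorem charpoly_eq_prod_eigsDesc {n : ℕ} {A : Matrix (Fin n) (Fin n) ℂ} (hA : A.IsHermitian) :
    A.charpoly = ∏ i, (Polynomial.X - Polynomial.C (eigsDesc hA i : ℂ)) := by
  rw [hA.charpoly_eq]
  exact (Equiv.prod_comp (Fin.revPerm.trans (Tuple.sort hA.eigenvalues))
    fun i => Polynomial.X - Polynomial.C (hA.eigenvalues i : ℂ)).symm

section
variable {p q : ℕ} (A : Matrix (Fin p) (Fin q) ℂ)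

theorem singularValues_antitone : Antitone (singularValues A) :=
  fun _ _ hij => Real.sqrt_le_sqrt (eigsDesc_antitone _ hij)

open scoped ComplexOrder in
theorem singularValues_sq (i : Fin q) :
    singularValues A i ^ 2 = eigsDesc (Matrix.isHermitian_conjTranspose_mul_self A) i :=
  Real.sq_sqrt ((Matrix.posSemidef_conjTranspose_mul_self A).eigenvalues_nonneg _)

theorem sval_nonneg (k : ℕ) : 0 ≤ sval A k := by
  unfold sval
  split_ifs
  · exact Real.sqrt_nonneg _
  · exact le_rfl

theorem sval_eq_zero {k : ℕ} (hk : q < k) : sval A k = 0 :=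
  dif_neg (by omega)

theorem sval_antitone : Antitone (sval A) := by
  intro k l hkl
  by_cases hl : l - 1 < q
  · have hk : k - 1 < q := by omega
    simp only [sval, hl, hk, dif_pos]
    exact singularValues_antitone A (Fin.mk_le_mk.mpr (by omega))
  · simpa only [sval, hl, dif_neg, not_false_eq_true] using sval_nonneg A k

theorem sval_succ (i : Fin q) : sval A (i + 1) = singularValues A i := by
  simp [sval]

/-- The Jordan–Wielandt matrix of `A`. -/
def jordanWielandt : Matrix (Fin p ⊕ Fin q) (Fin p ⊕ Fin q) ℂ :=
  Matrix.fromBlocks 0 A Aᴴ 0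

theorem jordanWielandt_add (A B : Matrix (Fin p) (Fin q) ℂ) :
    jordanWielandt (A + B) = jordanWielandt A + jordanWielandt B := by
  simp [jordanWielandt, Matrix.fromBlocks_add]

theorem isHermitian_jordanWielandt : (jordanWielandt A).IsHermitian := by
  simp [jordanWielandt, Matrix.IsHermitian, Matrix.fromBlocks_conjTranspose]

open Polynomial in
theorem X_pow_mul_charpoly_jordanWielandt :
    (jordanWielandt A).charpoly * X ^ q = X ^ p * (Aᴴ * A).charpoly.comp (X ^ 2) := by
  have h : (jordanWielandt A).charmatrix *
      Matrix.fromBlocks 1 (A.map C) 0 (Matrix.scalar (Fin q) X) =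
      Matrix.fromBlocks (Matrix.scalar (Fin p) X) 0 (-Aᴴ.map C)
        ((Aᴴ * A).charmatrix.map fun f => f.comp (X ^ 2)) := by
    rw [jordanWielandt, Matrix.charmatrix_fromBlocks, Matrix.fromBlocks_multiply]
    congr 1
    · simp [charmatrix]
    · ext i j : 1
      simp [charmatrix, Matrix.mul_apply, Matrix.diagonal_apply]
    · simp
    · ext i j : 1
      by_cases hij : i = j
      · subst hij
        simp [charmatrix, Matrix.mul_apply, sq, neg_add_eq_sub]
      · simp [charmatrix, Matrix.mul_apply, hij]
  have h' := congrArg Matrix.det h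
  rw [Matrix.det_mul, Matrix.det_fromBlocks_zero₂₁, Matrix.det_fromBlocks_zero₁₂] at h'
  have hc : ((Aᴴ * A).charmatrix.map fun f => f.comp (X ^ 2)).det =
      (Aᴴ * A).charpoly.comp (X ^ 2) :=
    ((Polynomial.compRingHom (X ^ 2 : ℂ[X])).map_det _).symm
  rw [hc] at h'
  simpa [Matrix.charpoly] using h'

open Polynomial in
theorem charpoly_jordanWielandt (hpq : q ≤ p) :
    (jordanWielandt A).charpoly =
      ∏ i : Fin (p + q), (X - C ((sval A (i + 1) - sval A (p + q - i) : ℝ) : ℂ)) := by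
  refine mul_right_cancel₀ (pow_ne_zero q (X_ne_zero (R := ℂ))) ?_
  rw [X_pow_mul_charpoly_jordanWielandt, charpoly_eq_prod_eigsDesc
    (Matrix.isHermitian_conjTranspose_mul_self A), Polynomial.prod_comp]
  have hfac (i : Fin q) :
      (X - C (eigsDesc (Matrix.isHermitian_conjTranspose_mul_self A) i : ℂ)).comp (X ^ 2) =
        (X - C (sval A (i + 1) : ℂ)) * (X + C (sval A (i + 1) : ℂ)) := by
    rw [← singularValues_sq, sval_succ]
    simp
    ring
  rw [Finset.prod_congr rfl fun i _ => hfac i, Finset.prod_mul_distrib,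
    Fin.prod_univ_eq_prod_range (fun i => X - C (sval A (i + 1) : ℂ)),
    Fin.prod_univ_eq_prod_range (fun i => X + C (sval A (i + 1) : ℂ)),
    Fin.prod_univ_eq_prod_range
      (fun i => X - C ((sval A (i + 1) - sval A (p + q - i) : ℝ) : ℂ))]
  obtain ⟨m, rfl⟩ := Nat.exists_eq_add_of_le hpq
  rw [Finset.prod_range_add, Finset.prod_range_add,
    ← Finset.prod_range_reflect (fun i => X + C (sval A (i + 1) : ℂ))]
  have h1 : ∏ i ∈ Finset.range q,
      (X - C ((sval A (i + 1) - sval A (q + m + q - i) : ℝ) : ℂ)) =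
      ∏ i ∈ Finset.range q, (X - C (sval A (i + 1) : ℂ)) := by
    refine Finset.prod_congr rfl fun i hi => ?_
    rw [Finset.mem_range] at hi
    rw [sval_eq_zero A (k := q + m + q - i) (by omega), sub_zero]
  have h2 : ∏ i ∈ Finset.range m,
      (X - C ((sval A (q + i + 1) - sval A (q + m + q - (q + i)) : ℝ) : ℂ)) = X ^ m := by
    refine (Finset.prod_eq_pow_card fun i hi => ?_).trans (by rw [Finset.card_range])
    rw [Finset.mem_range] at hi
    rw [sval_eq_zero A (k := q + m + q - (q + i)) (by omega),
      sval_eq_zero A (k := q + i + 1) (by omega)]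
    simp
  have h3 : ∏ i ∈ Finset.range q,
      (X - C ((sval A (q + m + i + 1) - sval A (q + m + q - (q + m + i)) : ℝ) : ℂ)) =
      ∏ i ∈ Finset.range q, (X + C (sval A (q - 1 - i + 1) : ℂ)) := by
    refine Finset.prod_congr rfl fun i hi => ?_
    rw [Finset.mem_range] at hi
    rw [sval_eq_zero A (k := q + m + i + 1) (by omega),
      show q + m + q - (q + m + i) = q - 1 - i + 1 by omega]
    simp
  rw [h1, h2, h3, pow_add]
  ring

theorem isSymmetric_toEuclideanLin_jordanWielandt :
    (Matrix.toEuclideanLin (jordanWielandt A)).IsSymmetric :=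
  Matrix.isSymmetric_toEuclideanLin_iff.mpr (isHermitian_jordanWielandt A)

theorem eigenvalues_jordanWielandt (hpq : q ≤ p)
    (hn : Module.finrank ℂ (EuclideanSpace ℂ (Fin p ⊕ Fin q)) = p + q) (i : Fin (p + q)) :
    (isSymmetric_toEuclideanLin_jordanWielandt A).eigenvalues hn i =
      sval A (i + 1) - sval A (p + q - i) := by
  refine congrFun ((isSymmetric_toEuclideanLin_jordanWielandt A).eigenvalues_eq_of_charpoly_eq hn
    (d := fun i => sval A (i + 1) - sval A (p + q - i)) (fun i j hij => ?_) ?_) i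
  · have hij' : (i : ℕ) ≤ j := hij
    exact sub_le_sub (sval_antitone A (by omega)) (sval_antitone A (by omega))
  · rw [← charpoly_jordanWielandt A hpq]
    exact Matrix.charpoly_toLin _ (PiLp.basisFun 2 ℂ _)

end

/-- **Signed Lidskii inequality for singular values.**  For `p ≥ q ≥ 1`, complex `p × q`
matrices `A`, `B`, a subset `{i_1 < … < i_r}` of `[q]` (encoded by a strictly monotone map
`ι : Fin r → ℕ` with values in `[q]`) and an index `s ∈ [r]`, one has
`∑_{k≠s} τ_{i_k}(A+B) − τ_{i_s}(A+B) ≤ ∑_{k≠s} τ_{i_k}(B) − τ_{i_s}(B) + ∑_{k=1}^r τ_k(A)`. -/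
theorem signed_lidskii_inequality_singular_values (p q r : ℕ) (hq : 1 ≤ q) (hpq : q ≤ p)
    (A B : Matrix (Fin p) (Fin q) ℂ)
    (ι : Fin r → ℕ) (hmono : StrictMono ι) (hrange : ∀ k, 1 ≤ ι k ∧ ι k ≤ q)
    (s : Fin r) :
    (∑ k ∈ Finset.univ.erase s, sval (A + B) (ι k)) - sval (A + B) (ι s) ≤
      (∑ k ∈ Finset.univ.erase s, sval B (ι k)) - sval B (ι s)
        + ∑ k : Fin r, sval A (k.val + 1) := by
  have hn : Module.finrank ℂ (EuclideanSpace ℂ (Fin p ⊕ Fin q)) = p + q := by simp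
  have hrq : r ≤ q := by
    have := Fintype.card_le_of_injective (fun k : Fin r => (⟨ι k - 1, by grind⟩ : Fin q))
      (fun k l hkl => hmono.injective (by simp only [Fin.mk.injEq] at hkl; grind))
    simpa using this
  let f : Fin r → Fin (p + q) := fun k =>
    if k = s then ⟨p + q - ι k, by grind⟩ else ⟨ι k - 1, by grind⟩
  have hf : Function.Injective f := by
    intro k l hkl
    have hk := hrange k
    have hl := hrange l
    simp only [f] at hkl
    split_ifs at hkl with h1 h2 h2
    · rw [h1, h2]
    all_goals simp only [Fin.mk.injEq] at hkl
    · omega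
    · omega
    · exact hmono.injective (by omega)
  have key := (isSymmetric_toEuclideanLin_jordanWielandt A).sum_eigenvalues_add_le
    (isSymmetric_toEuclideanLin_jordanWielandt B) hn (r := r) (by omega) hf
  have hval (M : Matrix (Fin p) (Fin q) ℂ) :
      ∑ k, (isSymmetric_toEuclideanLin_jordanWielandt M).eigenvalues hn (f k) =
        (∑ k ∈ Finset.univ.erase s, sval M (ι k)) - sval M (ι s) := by
    rw [← Finset.sum_erase_add _ _ (Finset.mem_univ s), sub_eq_add_neg]
    congr 1
    · refine Finset.sum_congr rfl fun k hk => ?_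
      have := hrange k
      rw [eigenvalues_jordanWielandt M hpq, show f k = ⟨ι k - 1, by omega⟩ from
        if_neg (Finset.ne_of_mem_erase hk)]
      simp only
      rw [sval_eq_zero M (k := p + q - (ι k - 1)) (by omega), Nat.sub_add_cancel this.1, sub_zero]
    · have := hrange s
      rw [eigenvalues_jordanWielandt M hpq, show f s = ⟨p + q - ι s, by omega⟩ from if_pos rfl]
      simp only
      rw [sval_eq_zero M (k := p + q - ι s + 1) (by omega), zero_sub,
        Nat.sub_sub_self (by omega)]
  have htop (k : Fin r) : (isSymmetric_toEuclideanLin_jordanWielandt A).eigenvalues hn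
      (Fin.castLE (by omega) k) = sval A (k.val + 1) := by
    rw [eigenvalues_jordanWielandt A hpq, Fin.val_castLE,
      sval_eq_zero A (k := p + q - k) (by omega), sub_zero]
  rw [hval, Finset.sum_congr rfl fun k _ => htop k] at key
  rw [← hval (A + B)]
  simpa only [jordanWielandt_add, map_add] using key
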